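/- arXiv:2203.13749 — 5 statements merged into one kernel-verified Lean document; each statement's English description precedes it below -/
import Mathlib

section
/- Let L > 0 and σ, q ∈ ℂ with q² = σ² − 1 and q ≠ 0. Suppose u : ℝ → ℂ is continuously differentiable, u(x) = e^{iσx} + r·e^{−iσx} for all x ≤ −L, u(x) = t·e^{iσx} for all x ≥ L, and u is twice differentiable on (−L, L) with u''(x) = −q²·u(x) there. Then the reflection coefficient r satisfies K·r = e^{−2iσL + 2iqL} − e^{−2iσL − 2iqL}, where K = ((q + σ)/(q − σ))·e^{−2iqL} − ((q − σ)/(q + σ))·e^{2iqL}. -/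
open Complex Set

theorem hasDerivAt_exp_const_mul_ofReal (c : ℂ) (x : ℝ) :
    HasDerivAt (fun x : ℝ => exp (c * x)) (c * exp (c * x)) x := by
  simpa [mul_comm] using ((hasDerivAt_id x).ofReal_comp.const_mul c).cexp

/-- If `u'' = -q² u` on the interior of an interval, then `(u' + i q u) e^{-iqx}` takes the same
value at both endpoints. -/
theorem deriv_add_mul_exp_eq_of_helmholtz {a b : ℝ} (hab : a ≤ b) (q : ℂ) {u : ℝ → ℂ}
    (hu : ContDiff ℝ 1 u)
    (hode : ∀ x ∈ Set.Ioo a b, HasDerivAt (deriv u) (-(q ^ 2) * u x) x) :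
    (deriv u b + I * q * u b) * exp (-(I * q) * b)
      = (deriv u a + I * q * u a) * exp (-(I * q) * a) := by
  have hu' : Continuous (deriv u) := hu.continuous_deriv le_rfl
  have hc := hu.continuous
  have h := intervalIntegral.integral_eq_sub_of_hasDerivAt_of_le
    (f := fun x : ℝ => (deriv u x + I * q * u x) * exp (-(I * q) * x)) (f' := fun _ => 0) hab
    (by fun_prop) (fun x hx => ?_) (by simp)
  · simpa [sub_eq_zero, eq_comm] using h
  · have h1 : HasDerivAt u (deriv u x) x := (hu.differentiable one_ne_zero x).hasDerivAt
    refine (((hode x hx).add (h1.const_mul (I * q))).mul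
      (hasDerivAt_exp_const_mul_ofReal (-(I * q)) x)).congr_deriv ?_
    simp only [Pi.add_apply]
    linear_combination (-q ^ 2 * u x * exp (-(I * q) * x)) * I_sq

/-- Two functions that agree on a set have the same derivative at any point of the set where the
set has the unique differentiability property. -/
theorem deriv_eq_of_eqOn {u v : ℝ → ℂ} {s : Set ℝ} {x : ℝ} {v' : ℂ} (hs : UniqueDiffWithinAt ℝ s x)
    (hx : x ∈ s) (hu : DifferentiableAt ℝ u x) (hv : HasDerivAt v v' x) (h : EqOn u v s) :
    deriv u x = v' :=
  hs.eq_deriv s hu.hasDerivAt.hasDerivWithinAt (hv.hasDerivWithinAt.congr h (h hx))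

/-- Rectangular barrier scattering: the reflection coefficient satisfies
`K · r = e^{−2iσL + 2iqL} − e^{−2iσL − 2iqL}`. -/
theorem barrier_reflection_coefficient
    (L : ℝ) (hL : 0 < L) (σ q r t : ℂ)
    (hq : q ^ 2 = σ ^ 2 - 1) (hq0 : q ≠ 0)
    (u : ℝ → ℂ) (hu : ContDiff ℝ 1 u)
    (huL : ∀ x : ℝ, x ≤ -L →
      u x = Complex.exp (Complex.I * σ * x) + r * Complex.exp (-(Complex.I * σ * x)))
    (huR : ∀ x : ℝ, L ≤ x → u x = t * Complex.exp (Complex.I * σ * x))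
    (huM : ∀ x ∈ Set.Ioo (-L) L, HasDerivAt (deriv u) (-(q ^ 2) * u x) x) :
    ((q + σ) / (q - σ) * Complex.exp (-2 * Complex.I * q * L)
        - (q - σ) / (q + σ) * Complex.exp (2 * Complex.I * q * L)) * r
      = Complex.exp (-2 * Complex.I * σ * L + 2 * Complex.I * q * L)
        - Complex.exp (-2 * Complex.I * σ * L - 2 * Complex.I * q * L) := by
  have hd : Differentiable ℝ u := hu.differentiable one_ne_zero
  have hdR : deriv u L = t * (I * σ * exp (I * σ * L)) :=
    deriv_eq_of_eqOn (uniqueDiffOn_Ici L L self_mem_Ici) self_mem_Ici (hd L)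
      ((hasDerivAt_exp_const_mul_ofReal (I * σ) L).const_mul t) huR
  have hdL : deriv u (-L) = I * σ * exp (I * σ * (-L : ℝ))
      + r * (-(I * σ) * exp (-(I * σ) * (-L : ℝ))) :=
    deriv_eq_of_eqOn (uniqueDiffOn_Iic (-L) (-L) self_mem_Iic) self_mem_Iic (hd (-L))
      ((hasDerivAt_exp_const_mul_ofReal (I * σ) (-L)).add
        ((hasDerivAt_exp_const_mul_ofReal (-(I * σ)) (-L)).const_mul r))
      fun x hx => by simpa using huL x hx
  have hplus := deriv_add_mul_exp_eq_of_helmholtz (neg_le_self hL.le) q hu huM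
  have hminus := deriv_add_mul_exp_eq_of_helmholtz (neg_le_self hL.le) (-q) hu (by simpa only [neg_sq] using huM)
  rw [hdR, hdL, huR L le_rfl, huL (-L) le_rfl] at hplus hminus
  have hσq : (q - σ) * (q + σ) = -1 := by linear_combination hq
  have hsub : q - σ ≠ 0 := left_ne_zero_of_mul (hσq.trans_ne (by norm_num))
  have hadd : q + σ ≠ 0 := right_ne_zero_of_mul (hσq.trans_ne (by norm_num))
  have hdiv₁ : (q + σ) / (q - σ) = -(q + σ) ^ 2 := by
    rw [div_eq_iff hsub]; linear_combination (q + σ) * hσq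
  have hdiv₂ : (q - σ) / (q + σ) = -(q - σ) ^ 2 := by
    rw [div_eq_iff hadd]; linear_combination (q - σ) * hσq
  have hE : exp (I * σ * L) * exp (-(I * σ * L)) = 1 := by rw [← exp_add]; simp
  have hQ : exp (I * q * L) * exp (-(I * q * L)) = 1 := by rw [← exp_add]; simp
  have e₁ : exp (-2 * I * q * L) = exp (-(I * q * L)) ^ 2 := by
    rw [← exp_nat_mul]; congr 1; push_cast; ring
  have e₂ : exp (2 * I * q * L) = exp (I * q * L) ^ 2 := by
    rw [← exp_nat_mul]; congr 1; push_cast; ring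
  have e₃ : exp (-2 * I * σ * L) = exp (-(I * σ * L)) ^ 2 := by
    rw [← exp_nat_mul]; congr 1; push_cast; ring
  rw [sub_eq_add_neg (-2 * I * σ * L), exp_add, exp_add, e₃,
    show -(2 * I * q * L) = -2 * I * q * L by ring, e₁, e₂, hdiv₁, hdiv₂]
  simp only [ofReal_neg, mul_neg, neg_mul, neg_neg] at hplus hminus
  generalize exp (I * σ * L) = E at *
  generalize exp (-(I * σ * L)) = F at *
  generalize exp (I * q * L) = P at *
  generalize exp (-(I * q * L)) = M at *
  have hplus' : (σ + q) * t * E * M = ((σ + q) * F + (q - σ) * r * E) * P :=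
    mul_left_cancel₀ I_ne_zero (by linear_combination hplus)
  have hminus' : (σ - q) * t * E * P = ((σ - q) * F - (σ + q) * r * E) * M :=
    mul_left_cancel₀ I_ne_zero (by linear_combination hminus)
  have key : F * (P ^ 2 - M ^ 2) = r * E * ((q - σ) ^ 2 * P ^ 2 - (q + σ) ^ 2 * M ^ 2) := by
    linear_combination (σ + q) * M * hminus' - (σ - q) * P * hplus'
      + F * (P ^ 2 - M ^ 2) * hσq
  linear_combination -F * key - r * ((q - σ) ^ 2 * P ^ 2 - (q + σ) ^ 2 * M ^ 2) * hE
end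

section
/- Let σ, q ∈ ℂ with q² = σ² − 1 and Im q ≠ 0, and let L₁, L₂ ∈ ℝ. If ((q + σ)/(q − σ))² = e^{4iqL₁} and ((q + σ)/(q − σ))² = e^{4iqL₂}, then L₁ = L₂. That is, a single resonance σ with Im q ≠ 0 determines the rectangular barrier uniquely. -/
open Complex

/-- A single resonance `σ` with `Im q ≠ 0` determines the rectangular barrier
uniquely: two half-widths with the same resonance relation coincide. -/
theorem barrier_width_unique_from_resonance
    (σ q : ℂ) (hq : q ^ 2 = σ ^ 2 - 1) (hIm : q.im ≠ 0) (L₁ L₂ : ℝ)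
    (h₁ : ((q + σ) / (q - σ)) ^ 2 = Complex.exp (4 * Complex.I * q * L₁))
    (h₂ : ((q + σ) / (q - σ)) ^ 2 = Complex.exp (4 * Complex.I * q * L₂)) :
    L₁ = L₂ := by
  have h := congrArg norm (h₁.symm.trans h₂)
  rw [norm_exp, norm_exp, Real.exp_eq_exp] at h
  simpa [hIm] using h
end

section
/- Let Λ > 0 and let O = (0, 1/(3√Λ)). There exist functions R₁, R₂ : ℝ → ℝ that are real-analytic on O such that for every m ∈ O, R₁(m) < R₂(m) and R₁(m), R₂(m) are precisely the two zeros of r ↦ 1 − 2m/r − (Λ/3)r² in (0, ∞). That is, the horizon radii r_bH(m) and r_sI(m) depend real-analytically on the mass m ∈ O. -/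
open Set

lemma analyticAt_arcsin_of_ne {x : ℝ} (h₁ : x ≠ -1) (h₂ : x ≠ 1) :
    AnalyticAt ℝ Real.arcsin x :=
  (Real.contDiffAt_arcsin h₁ h₂ (n := ⊤)).analyticAt

/-- A depressed cubic with two distinct roots `a`, `b` has third root `-(a + b)`. -/
lemma depressed_cubic_eq_zero_iff {p q a b : ℝ} (hab : a ≠ b)
    (ha : 4 * a ^ 3 - p * a + q = 0) (hb : 4 * b ^ 3 - p * b + q = 0) (s : ℝ) :
    4 * s ^ 3 - p * s + q = 0 ↔ s = a ∨ s = b ∨ s = -(a + b) := by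
  have hp : p = 4 * (a ^ 2 + a * b + b ^ 2) := by
    apply mul_left_cancel₀ (sub_ne_zero.mpr hab)
    linear_combination hb - ha
  have hq : q = 4 * a * b * (a + b) := by
    linear_combination ha + a * hp
  have hfac : 4 * s ^ 3 - p * s + q = 4 * ((s - a) * ((s - b) * (s + (a + b)))) := by
    rw [hp, hq]; ring
  rw [hfac]
  simp [sub_eq_zero, add_eq_zero_iff_eq_neg]

/-- The horizon radii `r_bH(m) < r_sI(m)` depend real-analytically on the mass
`m ∈ O = (0, 1/(3√Λ))`. -/
theorem deSitterSchwarzschild_horizons_analytic_in_mass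
    (Λ : ℝ) (hΛ : 0 < Λ) :
    ∃ R₁ R₂ : ℝ → ℝ,
      AnalyticOnNhd ℝ R₁ (Set.Ioo 0 (1 / (3 * Real.sqrt Λ)))
      ∧ AnalyticOnNhd ℝ R₂ (Set.Ioo 0 (1 / (3 * Real.sqrt Λ)))
      ∧ ∀ m ∈ Set.Ioo (0 : ℝ) (1 / (3 * Real.sqrt Λ)),
          R₁ m < R₂ m
          ∧ (∀ r : ℝ, 0 < r →
              (1 - 2 * m / r - (Λ / 3) * r ^ 2 = 0 ↔ r = R₁ m ∨ r = R₂ m)) := by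
  have hl : 0 < √Λ := Real.sqrt_pos.mpr hΛ
  have hll : √Λ ^ 2 = Λ := Real.sq_sqrt hΛ.le
  have hx : ∀ m ∈ Ioo (0 : ℝ) (1 / (3 * √Λ)), 0 < 3 * √Λ * m ∧ 3 * √Λ * m < 1 := by
    rintro m ⟨h0, h1⟩
    refine ⟨by positivity, ?_⟩
    rw [lt_div_iff₀ (by positivity)] at h1
    linarith
  have harc : ∀ m ∈ Ioo (0 : ℝ) (1 / (3 * √Λ)),
      AnalyticAt ℝ (fun m => Real.arcsin (3 * √Λ * m)) m := by
    intro m hm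
    obtain ⟨h0, h1⟩ := hx m hm
    exact (analyticAt_arcsin_of_ne (by linarith) h1.ne).comp_of_eq
      (analyticAt_const.mul analyticAt_id) rfl
  refine ⟨fun m => 2 / √Λ * Real.sin (Real.arcsin (3 * √Λ * m) / 3),
    fun m => 2 / √Λ * Real.sin ((Real.pi - Real.arcsin (3 * √Λ * m)) / 3), ?_, ?_, ?_⟩
  · intro m hm
    exact analyticAt_const.mul
      (Real.analyticAt_sin.comp_of_eq ((harc m hm).div analyticAt_const (by norm_num)) rfl)
  · intro m hm
    exact analyticAt_const.mul (Real.analyticAt_sin.comp_of_eq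
      ((analyticAt_const.sub (harc m hm)).div analyticAt_const (by norm_num)) rfl)
  intro m hm
  obtain ⟨h0, h1⟩ := hx m hm
  have ht0 := Real.arcsin_pos.mpr h0
  have ht1 := Real.arcsin_lt_pi_div_two.mpr h1
  have hsin := Real.sin_arcsin (by linarith) h1.le
  beta_reduce
  set t := Real.arcsin (3 * √Λ * m)
  have ha := Real.sin_three_mul (t / 3)
  have hb := Real.sin_three_mul ((Real.pi - t) / 3)
  rw [mul_div_cancel₀ _ (three_ne_zero), hsin] at ha
  rw [mul_div_cancel₀ _ (three_ne_zero), Real.sin_pi_sub, hsin] at hb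
  have hab : Real.sin (t / 3) < Real.sin ((Real.pi - t) / 3) :=
    Real.sin_lt_sin_of_lt_of_le_pi_div_two (by linarith) (by linarith) (by linarith)
  have hapos : 0 < Real.sin (t / 3) :=
    Real.sin_pos_of_pos_of_lt_pi (by linarith) (by linarith)
  refine ⟨by gcongr, fun r hr => ?_⟩
  have hcubic := depressed_cubic_eq_zero_iff (p := 3) (q := 3 * √Λ * m) hab.ne
    (by linarith) (by linarith) (√Λ * r / 2)
  have hscale : ∀ y : ℝ, r = 2 / √Λ * y ↔ √Λ * r / 2 = y := by
    intro y
    field_simp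
  have hne : √Λ * r / 2 ≠ -(Real.sin (t / 3) + Real.sin ((Real.pi - t) / 3)) := by
    have : 0 < √Λ * r / 2 := by positivity
    linarith
  have hpoly : 4 * (√Λ * r / 2) ^ 3 - 3 * (√Λ * r / 2) + 3 * √Λ * m
      = -(3 * √Λ * r / 2) * (1 - 2 * m / r - Λ / 3 * r ^ 2) := by
    field_simp
    rw [hll]
    ring
  rw [hpoly, mul_eq_zero_iff_left (by
    have : 0 < 3 * √Λ * r / 2 := by positivity
    linarith)] at hcubic
  rw [hcubic, hscale, hscale]
  simp only [hne, or_false]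
end

section
/- Let Λ > 0 and let O = (0, 1/(3√Λ)). With r_bH(m) < r_sI(m) denoting the two zeros in (0, ∞) of r ↦ 1 − 2m/r − (Λ/3)r², the surface gravity functions m ↦ β_bH(m) = m/r_bH(m)² − (Λ/3)·r_bH(m) and m ↦ β_sI(m) = m/r_sI(m)² − (Λ/3)·r_sI(m) are real-analytic on O; moreover β_bH(m) > 0 and β_sI(m) < 0 for every m ∈ O. -/
open Set

open Filter Topology

/-- An analytic function with nonzero derivative at `a` has an analytic local right inverse. -/
theorem AnalyticAt.exists_analyticAt_rightInverse {f : ℝ → ℝ} {a : ℝ} (hf : AnalyticAt ℝ f a)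
    (hf' : deriv f a ≠ 0) :
    ∃ g : ℝ → ℝ, AnalyticAt ℝ g (f a) ∧ g (f a) = a ∧ ∀ᶠ y in 𝓝 (f a), f (g y) = y := by
  refine ⟨_, hf.analyticAt_localInverse hf', ?_, ?_⟩
  · exact HasStrictFDerivAt.localInverse_apply_image _
  · exact HasStrictFDerivAt.eventually_right_inverse _

/-- A root function of a one-parameter family `p r = m` that is singled out by an open condition
`U` is analytic wherever the root is simple. -/
theorem analyticAt_of_eventually_isolated {p r : ℝ → ℝ} {U : Set ℝ} {m : ℝ}
    (hp : AnalyticAt ℝ p (r m)) (hp' : deriv p (r m) ≠ 0) (hm : p (r m) = m)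
    (hU : U ∈ 𝓝 (r m)) (huniq : ∀ᶠ y in 𝓝 m, ∀ x ∈ U, p x = y → x = r y) :
    AnalyticAt ℝ r m := by
  obtain ⟨g, hg, hgr, hpg⟩ := hp.exists_analyticAt_rightInverse hp'
  rw [hm] at hg hgr hpg
  have hgU : ∀ᶠ y in 𝓝 m, g y ∈ U := hg.continuousAt (by rwa [hgr])
  refine hg.congr ?_
  filter_upwards [huniq, hgU, hpg] with y h₁ h₂ h₃ using h₁ _ h₂ h₃

/-- A positive `r` is a horizon radius exactly when the mass equals `(r - (Λ / 3) * r ^ 3) / 2`. -/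
theorem horizon_iff_mass_eq (Λ m : ℝ) {r : ℝ} (hr : 0 < r) :
    1 - 2 * m / r - (Λ / 3) * r ^ 2 = 0 ↔ (r - Λ / 3 * r ^ 3) / 2 = m := by
  have h : 1 - 2 * m / r - (Λ / 3) * r ^ 2 = 2 * ((r - Λ / 3 * r ^ 3) / 2 - m) / r := by
    field_simp
    ring
  rw [h, div_eq_zero_iff, or_iff_left hr.ne', mul_eq_zero, or_iff_right two_ne_zero, sub_eq_zero]

theorem surface_gravity_eq {Λ m r : ℝ} (hr : 0 < r) (h : (r - Λ / 3 * r ^ 3) / 2 = m) :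
    m / r ^ 2 - (Λ / 3) * r = (1 - Λ * r ^ 2) / (2 * r) := by
  subst h
  field_simp
  ring

/-- Two distinct positive horizon radii lie on either side of `1 / √Λ`. -/
theorem horizon_radii_separated {Λ m a b : ℝ} (hΛ : 0 < Λ) (ha : 0 < a) (hab : a < b)
    (hma : (a - Λ / 3 * a ^ 3) / 2 = m) (hmb : (b - Λ / 3 * b ^ 3) / 2 = m) :
    Λ * a ^ 2 < 1 ∧ 1 < Λ * b ^ 2 := by
  have h : Λ * (a ^ 2 + a * b + b ^ 2) = 3 := by
    refine mul_left_cancel₀ (sub_pos.2 hab).ne' ?_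
    linear_combination 6 * hma - 6 * hmb
  have h₁ : Λ * a ^ 2 < Λ * (a * b) := by gcongr; nlinarith
  have h₂ : Λ * (a * b) < Λ * b ^ 2 := by gcongr; nlinarith
  constructor <;> linarith

theorem analyticAt_horizon_mass (Λ r : ℝ) :
    AnalyticAt ℝ (fun r : ℝ => (r - Λ / 3 * r ^ 3) / 2) r := by
  fun_prop

theorem deriv_horizon_mass (Λ r : ℝ) :
    deriv (fun r : ℝ => (r - Λ / 3 * r ^ 3) / 2) r = (1 - Λ * r ^ 2) / 2 := by
  have h := ((hasDerivAt_id r).sub ((hasDerivAt_pow 3 r).const_mul (Λ / 3))).div_const 2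
  refine h.deriv.trans ?_
  norm_num
  ring

/-- The surface gravities `β_bH(m) = m/r_bH(m)² − (Λ/3)r_bH(m)` and
`β_sI(m) = m/r_sI(m)² − (Λ/3)r_sI(m)` are real-analytic in `m ∈ O = (0, 1/(3√Λ))`,
with `β_bH(m) > 0` and `β_sI(m) < 0`. -/
theorem deSitterSchwarzschild_surface_gravities_analytic_in_mass
    (Λ : ℝ) (hΛ : 0 < Λ) (rbH rsI : ℝ → ℝ)
    (hroots : ∀ m ∈ Set.Ioo (0 : ℝ) (1 / (3 * Real.sqrt Λ)),
      0 < rbH m ∧ rbH m < rsI m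
      ∧ (∀ r : ℝ, 0 < r →
          (1 - 2 * m / r - (Λ / 3) * r ^ 2 = 0 ↔ r = rbH m ∨ r = rsI m))) :
    AnalyticOnNhd ℝ (fun m => m / (rbH m) ^ 2 - (Λ / 3) * rbH m)
        (Set.Ioo 0 (1 / (3 * Real.sqrt Λ)))
    ∧ AnalyticOnNhd ℝ (fun m => m / (rsI m) ^ 2 - (Λ / 3) * rsI m)
        (Set.Ioo 0 (1 / (3 * Real.sqrt Λ)))
    ∧ (∀ m ∈ Set.Ioo (0 : ℝ) (1 / (3 * Real.sqrt Λ)),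
        0 < m / (rbH m) ^ 2 - (Λ / 3) * rbH m
        ∧ m / (rsI m) ^ 2 - (Λ / 3) * rsI m < 0) := by
  set O := Set.Ioo (0 : ℝ) (1 / (3 * Real.sqrt Λ))
  have hpos : ∀ m ∈ O, 0 < rsI m := fun m hm => (hroots m hm).1.trans (hroots m hm).2.1
  have hmb : ∀ m ∈ O, (rbH m - Λ / 3 * rbH m ^ 3) / 2 = m := fun m hm =>
    (horizon_iff_mass_eq Λ m (hroots m hm).1).1 (((hroots m hm).2.2 _ (hroots m hm).1).2 (.inl rfl))
  have hms : ∀ m ∈ O, (rsI m - Λ / 3 * rsI m ^ 3) / 2 = m := fun m hm =>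
    (horizon_iff_mass_eq Λ m (hpos m hm)).1 (((hroots m hm).2.2 _ (hpos m hm)).2 (.inr rfl))
  have hsep : ∀ m ∈ O, Λ * rbH m ^ 2 < 1 ∧ 1 < Λ * rsI m ^ 2 := fun m hm =>
    horizon_radii_separated hΛ (hroots m hm).1 (hroots m hm).2.1 (hmb m hm) (hms m hm)
  have hcases : ∀ m ∈ O, ∀ x, 0 < x → (x - Λ / 3 * x ^ 3) / 2 = m → x = rbH m ∨ x = rsI m :=
    fun m hm x hx h => ((hroots m hm).2.2 x hx).1 ((horizon_iff_mass_eq Λ m hx).2 h)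
  have hanb : AnalyticOnNhd ℝ rbH O := by
    intro m hm
    refine analyticAt_of_eventually_isolated (U := {x | 0 < x ∧ Λ * x ^ 2 < 1})
      (analyticAt_horizon_mass Λ _) ?_ (hmb m hm) ?_ ?_
    · rw [deriv_horizon_mass]
      exact (half_pos (sub_pos.2 (hsep m hm).1)).ne'
    · exact ((isOpen_lt continuous_const continuous_id).inter
        (isOpen_lt (by fun_prop : Continuous fun x : ℝ => Λ * x ^ 2) continuous_const)).mem_nhds
        ⟨(hroots m hm).1, (hsep m hm).1⟩
    · filter_upwards [isOpen_Ioo.mem_nhds hm] with y hy x hx h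
      refine (hcases y hy x hx.1 h).resolve_right ?_
      rintro rfl
      exact hx.2.not_gt (hsep y hy).2
  have hans : AnalyticOnNhd ℝ rsI O := by
    intro m hm
    refine analyticAt_of_eventually_isolated (U := {x | 0 < x ∧ 1 < Λ * x ^ 2})
      (analyticAt_horizon_mass Λ _) ?_ (hms m hm) ?_ ?_
    · rw [deriv_horizon_mass]
      exact (div_neg_of_neg_of_pos (sub_neg.2 (hsep m hm).2) two_pos).ne
    · exact ((isOpen_lt continuous_const continuous_id).inter
        (isOpen_lt continuous_const (by fun_prop : Continuous fun x : ℝ => Λ * x ^ 2))).mem_nhds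
        ⟨hpos m hm, (hsep m hm).2⟩
    · filter_upwards [isOpen_Ioo.mem_nhds hm] with y hy x hx h
      refine (hcases y hy x hx.1 h).resolve_left ?_
      rintro rfl
      exact hx.2.not_gt (hsep y hy).1
  refine ⟨fun m hm => ?_, fun m hm => ?_, fun m hm => ⟨?_, ?_⟩⟩
  · exact (analyticAt_id.div ((hanb m hm).pow 2) (pow_pos (hroots m hm).1 2).ne').sub
      (analyticAt_const.mul (hanb m hm))
  · exact (analyticAt_id.div ((hans m hm).pow 2) (pow_pos (hpos m hm) 2).ne').sub
      (analyticAt_const.mul (hans m hm))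
  · rw [surface_gravity_eq (hroots m hm).1 (hmb m hm)]
    exact div_pos (sub_pos.2 (hsep m hm).1) (mul_pos two_pos (hroots m hm).1)
  · rw [surface_gravity_eq (hpos m hm) (hms m hm)]
    exact div_neg_of_neg_of_pos (sub_neg.2 (hsep m hm).2) (mul_pos two_pos (hpos m hm))
end

section
/- Let Λ > 0 and let O = (0, 1/(3√Λ)). With r_bH(m) < r_sI(m) denoting the two zeros in (0, ∞) of r ↦ 1 − 2m/r − (Λ/3)r², the function m ↦ r_bH(m) is strictly increasing on O and the function m ↦ r_sI(m) is strictly decreasing on O. In particular, each of the maps m ↦ r_bH(m) and m ↦ r_sI(m) is injective on O: the black hole mass is uniquely determined by either horizon radius. -/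
open Set

/-- A positive zero of `1 - 2m/r - (Λ/3)r²` solves the cubic `6m = 3r - Λr³`. -/
lemma six_mul_mass_eq_of_horizon {Λ m r : ℝ} (hr : 0 < r)
    (h : 1 - 2 * m / r - (Λ / 3) * r ^ 2 = 0) : 6 * m = 3 * r - Λ * r ^ 3 := by
  field_simp at h
  linarith

/-- The critical radius `1/√Λ` separates two positive solutions of the horizon cubic. -/
lemma horizons_separated {Λ m a b : ℝ} (hΛ : 0 < Λ) (ha : 0 < a) (hab : a < b)
    (hma : 6 * m = 3 * a - Λ * a ^ 3) (hmb : 6 * m = 3 * b - Λ * b ^ 3) :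
    Λ * a ^ 2 < 1 ∧ 1 < Λ * b ^ 2 := by
  have key : Λ * (a ^ 2 + a * b + b ^ 2) = 3 := by
    have hne : b - a ≠ 0 := by linarith
    apply mul_left_cancel₀ hne
    linear_combination hmb - hma
  have h₁ : Λ * a ^ 2 < Λ * (a * b) := by gcongr; nlinarith
  have h₂ : Λ * (a * b) < Λ * b ^ 2 := by gcongr; nlinarith
  constructor <;> linarith

/-- The cubic `3r - Λr³` is monotone below the critical radius. -/
lemma horizon_cubic_le_of_le {Λ r s : ℝ} (hΛ : 0 < Λ) (hrs : r ≤ s)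
    (hr : Λ * r ^ 2 ≤ 1) (hs : Λ * s ^ 2 ≤ 1) :
    3 * r - Λ * r ^ 3 ≤ 3 * s - Λ * s ^ 3 := by
  have h : 0 ≤ 3 - Λ * (r ^ 2 + r * s + s ^ 2) := by
    nlinarith [mul_nonneg hΛ.le (sq_nonneg (r - s))]
  linarith [mul_nonneg (sub_nonneg.2 hrs) h]

/-- The cubic `3r - Λr³` is antitone above the critical radius. -/
lemma horizon_cubic_ge_of_le {Λ r s : ℝ} (hΛ : 0 < Λ) (h₀ : 0 < r) (hrs : r ≤ s)
    (hr : 1 ≤ Λ * r ^ 2) : 3 * s - Λ * s ^ 3 ≤ 3 * r - Λ * r ^ 3 := by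
  have h₁ : Λ * r ^ 2 ≤ Λ * (r * s) := by gcongr; nlinarith
  have h₂ : Λ * r ^ 2 ≤ Λ * s ^ 2 := by gcongr
  have h : 0 ≤ Λ * (r ^ 2 + r * s + s ^ 2) - 3 := by linarith
  linarith [mul_nonneg (sub_nonneg.2 hrs) h]

/-- `m ↦ r_bH(m)` is strictly increasing and `m ↦ r_sI(m)` is strictly decreasing
on `O = (0, 1/(3√Λ))`; in particular each map is injective, so the mass is
determined by either horizon radius. -/
theorem deSitterSchwarzschild_horizons_monotone_in_mass
    (Λ : ℝ) (hΛ : 0 < Λ) (rbH rsI : ℝ → ℝ)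
    (hroots : ∀ m ∈ Set.Ioo (0 : ℝ) (1 / (3 * Real.sqrt Λ)),
      0 < rbH m ∧ rbH m < rsI m
      ∧ (∀ r : ℝ, 0 < r →
          (1 - 2 * m / r - (Λ / 3) * r ^ 2 = 0 ↔ r = rbH m ∨ r = rsI m))) :
    StrictMonoOn rbH (Set.Ioo 0 (1 / (3 * Real.sqrt Λ)))
    ∧ StrictAntiOn rsI (Set.Ioo 0 (1 / (3 * Real.sqrt Λ)))
    ∧ Set.InjOn rbH (Set.Ioo 0 (1 / (3 * Real.sqrt Λ)))
    ∧ Set.InjOn rsI (Set.Ioo 0 (1 / (3 * Real.sqrt Λ))) := by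
  have cubic : ∀ m ∈ Set.Ioo (0 : ℝ) (1 / (3 * Real.sqrt Λ)),
      6 * m = 3 * rbH m - Λ * rbH m ^ 3 ∧ 6 * m = 3 * rsI m - Λ * rsI m ^ 3 := by
    intro m hm
    obtain ⟨ha, hab, h⟩ := hroots m hm
    exact ⟨six_mul_mass_eq_of_horizon ha ((h _ ha).2 (.inl rfl)),
      six_mul_mass_eq_of_horizon (ha.trans hab) ((h _ (ha.trans hab)).2 (.inr rfl))⟩
  have sep : ∀ m ∈ Set.Ioo (0 : ℝ) (1 / (3 * Real.sqrt Λ)),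
      Λ * rbH m ^ 2 < 1 ∧ 1 < Λ * rsI m ^ 2 := fun m hm =>
    horizons_separated hΛ (hroots m hm).1 (hroots m hm).2.1 (cubic m hm).1 (cubic m hm).2
  have hmono : StrictMonoOn rbH (Set.Ioo 0 (1 / (3 * Real.sqrt Λ))) := by
    intro m hm n hn hmn
    by_contra! hle
    linarith [horizon_cubic_le_of_le hΛ hle (sep n hn).1.le (sep m hm).1.le,
      (cubic m hm).1, (cubic n hn).1]
  have hanti : StrictAntiOn rsI (Set.Ioo 0 (1 / (3 * Real.sqrt Λ))) := by
    intro m hm n hn hmn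
    by_contra! hle
    linarith [horizon_cubic_ge_of_le hΛ ((hroots m hm).1.trans (hroots m hm).2.1) hle
      (sep m hm).2.le, (cubic m hm).2, (cubic n hn).2]
  exact ⟨hmono, hanti, hmono.injOn, hanti.injOn⟩
end
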